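/- Let f: ℝⁿ×ℝᵐ→ℝⁿ and a stage cost ℓ: ℝⁿ×ℝᵐ→[0,∞) be given, with ℓ*(x) := inf_{u} ℓ(x,u), and suppose ℓ* is continuous and ℓ*(x) > 0 for all x ≠ 0. Assume there is a continuous function C: [0,∞)×ℝⁿ→[0,1], nonincreasing in its first argument, with C(t,x) < 1 for all x ∈ ℝⁿ and t > 0, such that V_t(x) ≤ t·C(t,x)·ℓ*(x) for all (t,x) ∈ [0,∞)×ℝⁿ. Fix T > δ > 0, x ∈ ℝⁿ with x ≠ 0, and let (x*, u*) be an optimal pair for horizon T from x (i.e. x*(0)=x, (x*)'=f(x*,u*) a.e., and ∫₀^T ℓ(x*(t),u*(t)) dt = V_T(x)). Then, with J_δ(x) := ∫₀^δ ℓ(x*(t),u*(t)) dt, the strict Lyapunov decrease V_T(x*(δ)) ≤ V_T(x) − (1 − C(δ, x*(T)))·J_δ(x) < V_T(x) holds. -/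

import Mathlib

open MeasureTheory Set Filter Topology

noncomputable def lamD {n : ℕ} (r : Fin n → ℝ) (α : ℝ) (x : Fin n → ℝ) : Fin n → ℝ :=
  fun i => α ^ (r i) * x i

noncomputable def dConst {n : ℕ} (r : Fin n → ℝ) : ℝ := 2 * ∏ i, r i

noncomputable def dilN {n : ℕ} (r : Fin n → ℝ) (x : Fin n → ℝ) : ℝ :=
  (∑ i, |x i| ^ (dConst r / r i)) ^ (dConst r)⁻¹

def IsHom {n m : ℕ} (f : (Fin n → ℝ) → (Fin m → ℝ) → (Fin n → ℝ))
    (r : Fin n → ℝ) (s : Fin m → ℝ) (τ : ℝ) : Prop :=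
  ∀ x u, ∀ α : ℝ, 0 ≤ α →
    f (lamD r α x) (lamD s α u) = fun i => α ^ τ * lamD r α (f x u) i

def IsTraj {n m : ℕ} (f : (Fin n → ℝ) → (Fin m → ℝ) → (Fin n → ℝ))
    (u : ℝ → Fin m → ℝ) (x : ℝ → Fin n → ℝ) (T : ℝ) : Prop :=
  Measurable u ∧
  (∃ C : ℝ, ∀ᵐ t ∂MeasureTheory.volume, t ∈ Set.Icc (0:ℝ) T → ‖u t‖ ≤ C) ∧
  ∀ t ∈ Set.Icc (0:ℝ) T,
    IntervalIntegrable (fun s => f (x s) (u s)) MeasureTheory.volume 0 t ∧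
    x t = x 0 + ∫ s in (0:ℝ)..t, f (x s) (u s)

noncomputable def stageCost {n m : ℕ} (r : Fin n → ℝ) (s : Fin m → ℝ)
    (x : Fin n → ℝ) (u : Fin m → ℝ) : ℝ :=
  ∑ i, |x i| ^ (dConst r / r i) + ∑ j, |u j| ^ (dConst r / s j)

noncomputable def lstar {n m : ℕ} (ℓ : (Fin n → ℝ) → (Fin m → ℝ) → ℝ)
    (x : Fin n → ℝ) : ℝ :=
  ⨅ u : Fin m → ℝ, ℓ x u

noncomputable def Val {n m : ℕ} (f : (Fin n → ℝ) → (Fin m → ℝ) → (Fin n → ℝ))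
    (ℓ : (Fin n → ℝ) → (Fin m → ℝ) → ℝ) (t : ℝ) (x0 : Fin n → ℝ) : ENNReal :=
  sInf { c | ∃ u x, IsTraj f u x t ∧ x 0 = x0 ∧
      c = ∫⁻ s in Set.Ioc (0:ℝ) t, ENNReal.ofReal (ℓ (x s) (u s)) }

def IsKInfty (ρ : ℝ → ℝ) : Prop :=
  Continuous ρ ∧ ρ 0 = 0 ∧ StrictMonoOn ρ (Set.Ici 0) ∧ ∀ c : ℝ, ∃ x ≥ (0:ℝ), c < ρ x

def LocLipOffZero {n m : ℕ} (f : (Fin n → ℝ) → (Fin m → ℝ) → (Fin n → ℝ)) : Prop :=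
  ∀ (u : Fin m → ℝ) (x : Fin n → ℝ), x ≠ 0 →
    ∃ (K : NNReal) (t : Set (Fin n → ℝ)), t ∈ nhds x ∧ LipschitzOnWith K (fun y => f y u) t

def GANC {n m : ℕ} (f : (Fin n → ℝ) → (Fin m → ℝ) → (Fin n → ℝ)) : Prop :=
  ∀ x0 : Fin n → ℝ, ∃ (u : ℝ → Fin m → ℝ) (x : ℝ → Fin n → ℝ),
    (∀ T > (0:ℝ), IsTraj f u x T) ∧ x 0 = x0 ∧
    Filter.Tendsto x Filter.atTop (nhds 0)

noncomputable def lowerDini {n : ℕ} (V : (Fin n → ℝ) → ℝ) (x v : Fin n → ℝ) : ℝ :=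
  Filter.liminf (fun p : ℝ × (Fin n → ℝ) => (V (x + p.1 • p.2) - V x) / p.1)
    ((nhdsWithin 0 (Set.Ioi 0)) ×ˢ nhds v)

namespace IsTraj

variable {n m : ℕ} {f : (Fin n → ℝ) → (Fin m → ℝ) → (Fin n → ℝ)}
  {u v : ℝ → Fin m → ℝ} {x y : ℝ → Fin n → ℝ} {T a b : ℝ}

theorem mono (h : IsTraj f u x T) (hab : a ≤ T) : IsTraj f u x a := by
  obtain ⟨hu, ⟨C, hC⟩, hx⟩ := h
  refine ⟨hu, ⟨C, ?_⟩, fun t ht => hx t ⟨ht.1, ht.2.trans hab⟩⟩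
  filter_upwards [hC] with t h ht using h ⟨ht.1, ht.2.trans hab⟩

theorem continuousOn (h : IsTraj f u x T) : ContinuousOn x (Icc 0 T) := by
  rcases lt_or_ge T 0 with hT | hT
  · simp [Icc_eq_empty_of_lt hT]
  · have hint := (h.2.2 T ⟨hT, le_rfl⟩).1
    rw [intervalIntegrable_iff_integrableOn_Icc_of_le hT] at hint
    exact (continuousOn_const.add (intervalIntegral.continuousOn_primitive_interval
      (by rwa [uIcc_of_le hT]))).congr (fun t ht => (h.2.2 t (by rwa [uIcc_of_le hT] at ht)).2)
      |>.mono (by rw [uIcc_of_le hT])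

theorem shift (h : IsTraj f u x T) (ha : 0 ≤ a) (haT : a ≤ T) :
    IsTraj f (fun t => u (t + a)) (fun t => x (t + a)) (T - a) := by
  obtain ⟨hu, ⟨C, hC⟩, hx⟩ := h
  refine ⟨hu.comp (measurable_id.add_const a), ⟨C, ?_⟩, fun t ht => ?_⟩
  · filter_upwards [(measurePreserving_add_right volume a).quasiMeasurePreserving.ae hC]
      with t h ht using h ⟨by linarith [ht.1], by linarith [ht.2]⟩
  · obtain ⟨hia, hxa⟩ := hx a ⟨ha, haT⟩
    obtain ⟨hit, hxt⟩ := hx (t + a) ⟨by linarith [ht.1], by linarith [ht.2]⟩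
    have hi := hia.symm.trans hit
    refine ⟨by simpa using hi.comp_add_right a, ?_⟩
    dsimp only
    rw [intervalIntegral.integral_comp_add_right (fun s => f (x s) (u s)) a, hxt, zero_add, hxa,
      add_assoc, intervalIntegral.integral_add_adjacent_intervals hia hi]

theorem concat (hx : IsTraj f u x a) (hy : IsTraj f v y b) (ha : 0 ≤ a) (hxy : y 0 = x a) :
    IsTraj f (fun t => if t ≤ a then u t else v (t - a))
      (fun t => if t ≤ a then x t else y (t - a)) (a + b) := by
  obtain ⟨hu, ⟨C, hC⟩, hx⟩ := hx
  obtain ⟨hv, ⟨D, hD⟩, hy⟩ := hy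
  refine ⟨Measurable.ite measurableSet_Iic hu (hv.comp (measurable_id.sub_const a)),
    ⟨max C D, ?_⟩, fun t ht => ?_⟩
  · filter_upwards [hC, (measurePreserving_sub_right volume a).quasiMeasurePreserving.ae hD]
      with t h h' ht
    split_ifs with hta
    · exact (h ⟨ht.1, hta⟩).trans (le_max_left _ _)
    · exact (h' ⟨by linarith, by linarith [ht.2]⟩).trans (le_max_right _ _)
  · have left : ∀ r, 0 ≤ r → r ≤ a → EqOn (fun s => f (x s) (u s))
        (fun s => f (if s ≤ a then x s else y (s - a)) (if s ≤ a then u s else v (s - a)))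
        (uIoc 0 r) := by
      intro r hr hra s hs
      rw [uIoc_of_le hr] at hs
      simp [hs.2.trans hra]
    rcases le_or_gt t a with hta | hta
    · obtain ⟨hi, he⟩ := hx t ⟨ht.1, hta⟩
      refine ⟨hi.congr (left t ht.1 hta), ?_⟩
      rw [← intervalIntegral.integral_congr_ae (.of_forall fun _ hs => left t ht.1 hta hs)]
      simpa [hta, ha] using he
    · have right : EqOn (fun s => f (y (s - a)) (v (s - a)))
          (fun s => f (if s ≤ a then x s else y (s - a)) (if s ≤ a then u s else v (s - a)))
          (uIoc a t) := by
        intro s hs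
        rw [uIoc_of_le hta.le] at hs
        simp [hs.1.not_ge]
      obtain ⟨hi, he⟩ := hx a ⟨ha, le_rfl⟩
      obtain ⟨hj, hf⟩ := hy (t - a) ⟨by linarith, by linarith [ht.2]⟩
      have hj' : IntervalIntegrable (fun s => f (y (s - a)) (v (s - a))) volume a t := by
        simpa using hj.comp_sub_right a
      have hi' := hi.congr (left a ha le_rfl)
      have hj'' := hj'.congr right
      refine ⟨hi'.trans hj'', ?_⟩
      rw [← intervalIntegral.integral_add_adjacent_intervals hi' hj'',
        ← intervalIntegral.integral_congr_ae (.of_forall fun _ hs => left a ha le_rfl hs),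
        ← intervalIntegral.integral_congr_ae (.of_forall fun _ hs => right hs),
        intervalIntegral.integral_comp_sub_right (fun s => f (y s) (v s)) a, sub_self, ← add_assoc]
      simp only [hta.not_ge, ha, if_true, if_false]
      rw [← he, ← hxy, hf]

end IsTraj

theorem setLIntegral_Ioc_comp_add_right (F : ℝ → ENNReal) (a b c : ℝ) :
    ∫⁻ s in Ioc b c, F (s + a) = ∫⁻ s in Ioc (b + a) (c + a), F s := by
  rw [(measurePreserving_add_right volume a).setLIntegral_comp_emb (measurableEmbedding_addRight a)]
  simp

theorem setLIntegral_Ioc_add_Ioc (F : ℝ → ENNReal) {a b c : ℝ} (hab : a ≤ b) (hbc : b ≤ c) :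
    (∫⁻ s in Ioc a b, F s) + ∫⁻ s in Ioc b c, F s = ∫⁻ s in Ioc a c, F s := by
  rw [← lintegral_union measurableSet_Ioc (Ioc_disjoint_Ioc_of_le le_rfl),
    Ioc_union_Ioc_eq_Ioc hab hbc]

section Value

variable {n m : ℕ} {f : (Fin n → ℝ) → (Fin m → ℝ) → (Fin n → ℝ)}
  {ℓ : (Fin n → ℝ) → (Fin m → ℝ) → ℝ} {u : ℝ → Fin m → ℝ} {x : ℝ → Fin n → ℝ} {a b T : ℝ}

/-- The easy half of the dynamic programming principle. -/
theorem Val_add_le (h : IsTraj f u x a) (ha : 0 ≤ a) (hb : 0 ≤ b) :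
    Val f ℓ (a + b) (x 0) ≤
      (∫⁻ s in Ioc (0 : ℝ) a, ENNReal.ofReal (ℓ (x s) (u s))) + Val f ℓ b (x a) := by
  conv_rhs => rw [Val, ENNReal.add_sInf]
  refine le_iInf₂ ?_
  rintro _ ⟨v, y, hy, hy0, rfl⟩
  refine sInf_le ⟨_, _, h.concat hy ha hy0, by simp [ha], ?_⟩
  rw [← setLIntegral_Ioc_add_Ioc _ ha (le_add_of_nonneg_right hb)]
  congr 1
  · refine setLIntegral_congr_fun measurableSet_Ioc fun s hs => ?_
    simp [hs.2]
  · rw [add_comm a b]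
    have hshift := setLIntegral_Ioc_comp_add_right (fun s => ENNReal.ofReal
      (ℓ (if s ≤ a then x s else y (s - a)) (if s ≤ a then u s else v (s - a)))) a 0 b
    rw [zero_add] at hshift
    rw [← hshift]
    refine setLIntegral_congr_fun measurableSet_Ioc fun s hs => ?_
    simp [hs.1.not_ge]

/-- Tails of optimal trajectories are optimal. -/
theorem setLIntegral_tail_le_Val (h : IsTraj f u x T)
    (hopt : ∫⁻ s in Ioc (0 : ℝ) T, ENNReal.ofReal (ℓ (x s) (u s)) = Val f ℓ T (x 0))
    (hfin : Val f ℓ T (x 0) ≠ ⊤) (ha : 0 ≤ a) (haT : a ≤ T) :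
    ∫⁻ s in Ioc a T, ENNReal.ofReal (ℓ (x s) (u s)) ≤ Val f ℓ (T - a) (x a) := by
  have hle := Val_add_le (ℓ := ℓ) (h.mono haT) ha (sub_nonneg.2 haT)
  have hsplit := setLIntegral_Ioc_add_Ioc
    (fun s => ENNReal.ofReal (ℓ (x s) (u s))) ha haT
  rw [add_sub_cancel, ← hopt, ← hsplit] at hle
  refine (ENNReal.add_le_add_iff_left ?_).1 hle
  exact ne_top_of_le_ne_top hfin (by rw [← hopt, ← hsplit]; exact le_self_add)

theorem Val_shift_le (h : IsTraj f u x T) (ha : 0 ≤ a) (haT : a ≤ T) (hb : 0 ≤ b) :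
    Val f ℓ (T - a + b) (x a) ≤
      (∫⁻ s in Ioc a T, ENNReal.ofReal (ℓ (x s) (u s))) + Val f ℓ b (x T) := by
  have hle := Val_add_le (ℓ := ℓ) (h.shift ha haT) (sub_nonneg.2 haT) hb
  rw [setLIntegral_Ioc_comp_add_right (fun s => ENNReal.ofReal (ℓ (x s) (u s)))] at hle
  simpa using hle

theorem lstar_nonneg (hℓ : ∀ x u, 0 ≤ ℓ x u) (z : Fin n → ℝ) : 0 ≤ lstar ℓ z :=
  Real.iInf_nonneg (hℓ z)

theorem lstar_le (hℓ : ∀ x u, 0 ≤ ℓ x u) (z : Fin n → ℝ) (w : Fin m → ℝ) :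
    lstar ℓ z ≤ ℓ z w :=
  ciInf_le ⟨0, forall_mem_range.2 (hℓ z)⟩ w

theorem ofReal_integral_lstar_le (hℓ : ∀ x u, 0 ≤ ℓ x u) (hab : a ≤ b)
    (hc : ContinuousOn (fun s => lstar ℓ (x s)) (Icc a b)) :
    ENNReal.ofReal (∫ s in a..b, lstar ℓ (x s)) ≤
      ∫⁻ s in Ioc a b, ENNReal.ofReal (ℓ (x s) (u s)) := by
  rw [intervalIntegral.integral_of_le hab, ofReal_integral_eq_lintegral_ofReal
    (hc.integrableOn_Icc.mono_set Ioc_subset_Icc_self)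
    (Eventually.of_forall fun s => lstar_nonneg hℓ (x s))]
  exact lintegral_mono fun s => ENNReal.ofReal_le_ofReal (lstar_le hℓ _ _)

end Value

/-- If every tail average of a continuous function is at most its initial value, then the function
is minimal at the right endpoint. -/
theorem right_endpoint_le_of_tail_integral_le {g : ℝ → ℝ} {a b : ℝ}
    (hg : ContinuousOn g (Icc a b))
    (h : ∀ s ∈ Icc a b, ∫ t in s..b, g t ≤ (b - s) * g s) {s : ℝ} (hs : s ∈ Icc a b) :
    g b ≤ g s := by
  obtain ⟨p, hp, hmin⟩ := isCompact_Icc.exists_isMinOn ⟨s, hs⟩ hg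
  refine le_trans ?_ (hmin hs)
  by_contra! hlt
  have hpb : p < b := lt_of_le_of_ne hp.2 (by rintro rfl; exact lt_irrefl _ hlt)
  have hsub : Icc p b ⊆ Icc a b := Icc_subset_Icc_left hp.1
  have := intervalIntegral.integral_lt_integral_of_continuousOn_of_le_of_exists_lt hpb
    (continuousOn_const (c := g p)) (hg.mono hsub)
    (fun t ht => hmin (hsub (Ioc_subset_Icc_self ht))) ⟨b, ⟨hpb.le, le_rfl⟩, hlt⟩
  rw [intervalIntegral.integral_const, smul_eq_mul] at this
  exact (this.trans_le (h p hp)).false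

/-- strict Lyapunov decrease of the finite horizon value function under
the growth condition V_t(x) ≤ t C(t,x) ℓ*(x). -/
theorem stmt14 {n m : ℕ}
    (f : (Fin n → ℝ) → (Fin m → ℝ) → (Fin n → ℝ))
    (ℓ : (Fin n → ℝ) → (Fin m → ℝ) → ℝ) (hℓnn : ∀ x u, 0 ≤ ℓ x u)
    (hlc : Continuous (lstar ℓ))
    (hlpos : ∀ x : Fin n → ℝ, x ≠ 0 → 0 < lstar ℓ x)
    (C : ℝ → (Fin n → ℝ) → ℝ)
    (hCc : Continuous (Function.uncurry C))
    (hCanti : ∀ x : Fin n → ℝ, AntitoneOn (fun t => C t x) (Set.Ici 0))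
    (hC01 : ∀ t ≥ (0:ℝ), ∀ x : Fin n → ℝ, C t x ∈ Set.Icc (0:ℝ) 1)
    (hClt : ∀ x : Fin n → ℝ, ∀ t > (0:ℝ), C t x < 1)
    (hgrow : ∀ t ≥ (0:ℝ), ∀ x : Fin n → ℝ,
      Val f ℓ t x ≤ ENNReal.ofReal (t * C t x * lstar ℓ x))
    (T δ : ℝ) (hδ : 0 < δ) (hδT : δ < T)
    (x : Fin n → ℝ) (hx : x ≠ 0)
    (ustar : ℝ → Fin m → ℝ) (xstar : ℝ → Fin n → ℝ)
    (htraj : IsTraj f ustar xstar T) (hinit : xstar 0 = x)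
    (hopt : (∫⁻ s in Set.Ioc (0:ℝ) T, ENNReal.ofReal (ℓ (xstar s) (ustar s)))
      = Val f ℓ T x) :
    Val f ℓ T (xstar δ)
        ≤ Val f ℓ T x - ENNReal.ofReal (1 - C δ (xstar T))
            * (∫⁻ s in Set.Ioc (0:ℝ) δ, ENNReal.ofReal (ℓ (xstar s) (ustar s))) ∧
    Val f ℓ T (xstar δ) < Val f ℓ T x := by
  subst hinit
  have hT : 0 < T := hδ.trans hδT
  have hfin : Val f ℓ T (xstar 0) ≠ ⊤ := ne_top_of_le_ne_top ENNReal.ofReal_ne_top (hgrow T hT.le _)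
  have hgc : ContinuousOn (fun s => lstar ℓ (xstar s)) (Icc 0 T) :=
    hlc.comp_continuousOn htraj.continuousOn
  have hmin : ∀ s ∈ Icc 0 T, lstar ℓ (xstar T) ≤ lstar ℓ (xstar s) := by
    refine fun s hs => right_endpoint_le_of_tail_integral_le hgc (fun p hp => ?_) hs
    have hTp : 0 ≤ T - p := sub_nonneg.2 hp.2
    have hl := lstar_nonneg hℓnn (xstar p)
    have hle := (ofReal_integral_lstar_le (u := ustar) hℓnn hp.2
      (hgc.mono (Icc_subset_Icc_left hp.1))).trans
      ((setLIntegral_tail_le_Val htraj hopt hfin hp.1 hp.2).trans (hgrow _ hTp _))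
    have hC := hC01 (T - p) hTp (xstar p)
    refine ((ENNReal.ofReal_le_ofReal_iff
      (mul_nonneg (mul_nonneg hTp hC.1) hl)).1 hle).trans ?_
    exact mul_le_mul_of_nonneg_right (mul_le_of_le_one_right hTp hC.2) hl
  set J := ∫⁻ s in Ioc (0 : ℝ) δ, ENNReal.ofReal (ℓ (xstar s) (ustar s))
  set R := ∫⁻ s in Ioc δ T, ENNReal.ofReal (ℓ (xstar s) (ustar s))
  have hsplit : J + R = Val f ℓ T (xstar 0) := by
    rw [← hopt]; exact setLIntegral_Ioc_add_Ioc _ hδ.le hδT.le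
  have hJtop : J ≠ ⊤ := ne_top_of_le_ne_top hfin (hsplit ▸ le_self_add)
  have hgδ : ContinuousOn (fun s => lstar ℓ (xstar s)) (Icc 0 δ) :=
    hgc.mono (Icc_subset_Icc_right hδT.le)
  have hIJ : ENNReal.ofReal (∫ s in (0 : ℝ)..δ, lstar ℓ (xstar s)) ≤ J :=
    ofReal_integral_lstar_le hℓnn hδ.le hgδ
  have hJpos : 0 < J := by
    refine (ENNReal.ofReal_pos.2 ?_).trans_le hIJ
    exact intervalIntegral.integral_pos hδ hgδ (fun s _ => lstar_nonneg hℓnn _)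
      ⟨0, ⟨le_rfl, hδ.le⟩, hlpos _ hx⟩
  have hδJ : ENNReal.ofReal (δ * lstar ℓ (xstar T)) ≤ J := by
    refine (ENNReal.ofReal_le_ofReal ?_).trans hIJ
    have := intervalIntegral.integral_mono_on (μ := volume) hδ.le intervalIntegrable_const
      (hgδ.intervalIntegrable_of_Icc hδ.le) fun s hs => hmin s ⟨hs.1, hs.2.trans hδT.le⟩
    simpa using this
  have hC := hC01 δ hδ.le (xstar T)
  have hCJ : Val f ℓ δ (xstar T) ≤ ENNReal.ofReal (C δ (xstar T)) * J := by
    refine (hgrow δ hδ.le _).trans ?_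
    rw [mul_comm δ, mul_assoc, ENNReal.ofReal_mul hC.1]
    gcongr
  have hdecr : Val f ℓ T (xstar δ) ≤
      Val f ℓ T (xstar 0) - ENNReal.ofReal (1 - C δ (xstar T)) * J := by
    refine ENNReal.le_sub_of_add_le_right (ENNReal.mul_ne_top ENNReal.ofReal_ne_top hJtop) ?_
    have hV := Val_shift_le (ℓ := ℓ) htraj hδ.le hδT.le hδ.le
    rw [sub_add_cancel] at hV
    calc _ ≤ R + ENNReal.ofReal (C δ (xstar T)) * J + ENNReal.ofReal (1 - C δ (xstar T)) * J := by
          gcongr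
          exact hV.trans (by gcongr)
      _ = Val f ℓ T (xstar 0) := by
          rw [add_assoc, ← add_mul, ← ENNReal.ofReal_add hC.1 (sub_nonneg.2 hC.2),
            add_sub_cancel, ENNReal.ofReal_one, one_mul, add_comm, hsplit]
  refine ⟨hdecr, hdecr.trans_lt (ENNReal.sub_lt_self hfin ?_ ?_)⟩
  · exact (hJpos.trans_le (hsplit ▸ le_self_add)).ne'
  · exact mul_ne_zero (ENNReal.ofReal_pos.2 (sub_pos.2 (hClt _ _ hδ))).ne' hJpos.ne'
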